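/- Suppose (V,b) ≈ (V',b') are nonsingular finite-dimensional metric spaces over F. Let E, A ⊆ V and E', A' ⊆ V' be subspaces such that E ⊆ A^⊥, E' ⊆ A'^⊥, A ≈ A', and φ : E → E' is an isometry with φ(E ∩ A) = E' ∩ A'. Then φ can be extended to an isometry φ_V : V → V' that sends A to A'. -/

import Mathlib

open Module

namespace Witt

variable {F V V' : Type*} [Field F] [AddCommGroup V] [Module F V]
  [AddCommGroup V'] [Module F V']

/-- A linear equivalence `φ : E ≃ E'` between subspaces is an isometry if it
preserves the ambient bilinear forms. -/
def IsIsometryOn (B : LinearMap.BilinForm F V) (B' : LinearMap.BilinForm F V')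
    (E : Submodule F V) (E' : Submodule F V') (φ : E ≃ₗ[F] E') : Prop :=
  ∀ u v : E, B' (φ u : V') (φ v : V') = B (u : V) (v : V)

/-- A linear equivalence of the whole spaces which preserves the forms. -/
def IsIsometry (B : LinearMap.BilinForm F V) (B' : LinearMap.BilinForm F V')
    (ψ : V ≃ₗ[F] V') : Prop :=
  ∀ u v : V, B' (ψ u) (ψ v) = B u v

/-- The two metric spaces `(V,B)` and `(V',B')` are isometric. -/
def AreIsometric (B : LinearMap.BilinForm F V) (B' : LinearMap.BilinForm F V') : Prop :=
  ∃ ψ : V ≃ₗ[F] V', IsIsometry B B' ψ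

/-- The subspaces `N ⊆ V` and `N' ⊆ V'` are isometric with respect to the
restrictions of the ambient forms. -/
def SubIsometric (B : LinearMap.BilinForm F V) (B' : LinearMap.BilinForm F V')
    (N : Submodule F V) (N' : Submodule F V') : Prop :=
  ∃ ψ : N ≃ₗ[F] N', IsIsometryOn B B' N N' ψ

/-- A subspace is totally isotropic. -/
def TotIsotropic (B : LinearMap.BilinForm F V) (N : Submodule F V) : Prop :=
  ∀ u ∈ N, ∀ v ∈ N, B u v = 0

end Witt

open Module Witt

namespace Witt

section Isometries

variable {F V : Type*} [Field F] [AddCommGroup V] [Module F V]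

/-- A form-preserving endomorphism of a nonsingular finite-dimensional space is an isometry. -/
lemma exists_isometry_of_preserves [FiniteDimensional F V] {B : LinearMap.BilinForm F V}
    (hnd : B.Nondegenerate) (f : V →ₗ[F] V) (hf : ∀ a b, B (f a) (f b) = B a b) :
    ∃ τ : V ≃ₗ[F] V, IsIsometry B B τ ∧ ∀ v, τ v = f v := by
  have hinj : Function.Injective f := by
    refine (injective_iff_map_eq_zero f).2 fun a ha => hnd.1 a fun b => ?_
    rw [← hf, ha, map_zero, LinearMap.zero_apply]
  exact ⟨LinearEquiv.ofInjectiveEndo f hinj, hf, fun _ => rfl⟩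

/-- The reflection in an anisotropic vector `u`. -/
lemma exists_reflection [FiniteDimensional F V] {B : LinearMap.BilinForm F V}
    (hB : ∀ u v, B u v = B v u) (hnd : B.Nondegenerate) {u : V} (hu : B u u ≠ 0) :
    ∃ τ : V ≃ₗ[F] V, IsIsometry B B τ ∧ ∀ h, τ h = h - (2 * B u h / B u u) • u := by
  obtain ⟨τ, hτ, hτf⟩ := exists_isometry_of_preserves hnd
    (LinearMap.id - ((2 / B u u) • B u).smulRight u) (by
      intro a b
      simp only [LinearMap.sub_apply, LinearMap.id_apply, LinearMap.smulRight_apply,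
        LinearMap.smul_apply, map_sub, map_smul, smul_eq_mul, hB a u]
      field_simp
      ring)
  exact ⟨τ, hτ, fun h => by simp [hτf, div_mul_eq_mul_div]⟩

/-- The Siegel transformation attached to an isotropic vector `u` and a vector `w` orthogonal
to `u`. -/
lemma exists_siegel_transformation [FiniteDimensional F V] (hchar : (2 : F) ≠ 0)
    {B : LinearMap.BilinForm F V} (hB : ∀ u v, B u v = B v u) (hnd : B.Nondegenerate) {u w : V}
    (hu : B u u = 0) (hw : B w u = 0) :
    ∃ τ : V ≃ₗ[F] V, IsIsometry B B τ ∧ ∀ h, B u h = 0 → τ h = h - B w h • u := by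
  obtain ⟨τ, hτ, hτf⟩ := exists_isometry_of_preserves hnd
    (LinearMap.id + (B u).smulRight w - (B w).smulRight u
      - ((B w w / 2) • B u).smulRight u) (by
      intro a b
      simp only [LinearMap.sub_apply, LinearMap.add_apply, LinearMap.id_apply,
        LinearMap.smulRight_apply, LinearMap.smul_apply, map_sub, map_add, map_smul, smul_eq_mul,
        hB a u, hB a w, hB u w, hu, hw]
      field_simp
      ring)
  exact ⟨τ, hτ, fun h hh => by simp [hτf, hh]⟩

/-- The scaling of a hyperbolic plane with hyperbolic pair `u`, `v`, extended by the identity. -/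
lemma exists_hyperbolic_scaling [FiniteDimensional F V]
    {B : LinearMap.BilinForm F V} (hB : ∀ u v, B u v = B v u) (hnd : B.Nondegenerate) {u v : V}
    (hu : B u u = 0) (hv : B v v = 0) (huv : B v u = 1) {c : F} (hc : c ≠ 0) :
    ∃ τ : V ≃ₗ[F] V, IsIsometry B B τ ∧ (∀ h, B u h = 0 → B v h = 0 → τ h = h) ∧
      τ u = c • u := by
  obtain ⟨τ, hτ, hτf⟩ := exists_isometry_of_preserves hnd
    (LinearMap.id + ((c - 1) • B v).smulRight u + ((c⁻¹ - 1) • B u).smulRight v) (by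
      intro a b
      simp only [LinearMap.add_apply, LinearMap.id_apply,
        LinearMap.smulRight_apply, LinearMap.smul_apply, map_add, map_smul, smul_eq_mul,
        hB a u, hB a v, hB u v, hu, hv, huv]
      field_simp
      ring)
  refine ⟨τ, hτ, fun h hh hh' => by simp [hτf, hh, hh'], ?_⟩
  simp [hτf, hu, huv, sub_smul]

lemma exists_mem_ker_apply_eq {H : Submodule F V} [FiniteDimensional F V]
    {B : LinearMap.BilinForm F V} (hnd : B.Nondegenerate) {x : V} (hx : x ∉ H) (c : F) :
    ∃ w, (∀ h ∈ H, B w h = 0) ∧ B w x = c := by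
  obtain ⟨f, hf, hfx⟩ := LinearMap.exists_extend_of_notMem (0 : H →ₗ[F] F) hx c
  refine ⟨(B.toDual hnd).symm f, fun h hh => ?_, ?_⟩
  · rw [LinearMap.BilinForm.apply_toDual_symm_apply]
    simpa using congr($hf ⟨h, hh⟩)
  · rw [LinearMap.BilinForm.apply_toDual_symm_apply, hfx]

/-- One-dimensional extension step of Witt's theorem. -/
lemma exists_isometry_fixing [FiniteDimensional F V] (hchar : (2 : F) ≠ 0)
    {B : LinearMap.BilinForm F V} (hB : ∀ u v, B u v = B v u) (hnd : B.Nondegenerate)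
    {H : Submodule F V} {x y : V} (hx : x ∉ H) (hy : y ∉ H)
    (hxy : B y y = B x x) (hH : ∀ h ∈ H, B y h = B x h) :
    ∃ τ : V ≃ₗ[F] V, IsIsometry B B τ ∧ (∀ h ∈ H, τ h = h) ∧ τ x = y := by
  obtain ⟨u, rfl⟩ : ∃ u, y = x + u := ⟨y - x, by abel⟩
  have hH' : ∀ h ∈ H, B u h = 0 := fun h hh => by simpa using hH h hh
  have hux : 2 * B u x = -B u u := by
    simp only [map_add, LinearMap.add_apply, hB x u] at hxy
    linear_combination hxy
  by_cases hu : B u u = 0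
  · replace hux : B u x = 0 := by
      rw [hu, neg_zero] at hux
      exact (mul_eq_zero.1 hux).resolve_left hchar
    by_cases hxu : x ∈ H ⊔ Submodule.span F {u}
    · obtain ⟨h₀, hh₀, z, hz, rfl⟩ := Submodule.mem_sup.1 hxu
      obtain ⟨c, rfl⟩ := Submodule.mem_span_singleton.1 hz
      have hc : c ≠ 0 := by
        rintro rfl
        exact hx (by simpa using hh₀)
      have hc' : c + 1 ≠ 0 := by
        intro h
        refine hy ?_
        have : h₀ + c • u + u = h₀ + (c + 1) • u := by module
        rw [this, h]
        simpa using hh₀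
      have huH : u ∉ H := fun h => hx (H.add_mem hh₀ (H.smul_mem c h))
      obtain ⟨v, hv, hvu⟩ := exists_mem_ker_apply_eq hnd huH 1
      obtain ⟨τ, hτ, hfix, hτu⟩ := exists_hyperbolic_scaling hB hnd (u := u)
        (v := v - (B v v / 2) • u) hu (by
          simp only [map_sub, map_smul, LinearMap.sub_apply, LinearMap.smul_apply, smul_eq_mul,
            hu, hvu, hB u v]
          field_simp
          ring) (by simp [hu, hvu]) (div_ne_zero hc' hc)
      have hτH : ∀ h ∈ H, τ h = h := fun h hh =>
        hfix h (hH' h hh) (by simp [hv h hh, hH' h hh])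
      refine ⟨τ, hτ, hτH, ?_⟩
      rw [map_add, map_smul, hτH h₀ hh₀, hτu, smul_smul, mul_div_cancel₀ _ hc]
      module
    · obtain ⟨w, hw, hwx⟩ := exists_mem_ker_apply_eq hnd hxu (-1)
      obtain ⟨τ, hτ, hτf⟩ := exists_siegel_transformation hchar hB hnd hu
        (hw u (Submodule.mem_sup_right (Submodule.mem_span_singleton_self u)))
      refine ⟨τ, hτ, fun h hh => ?_, ?_⟩
      · rw [hτf h (hH' h hh), hw h (Submodule.mem_sup_left hh), zero_smul, sub_zero]
      · rw [hτf x hux, hwx, neg_one_smul, sub_neg_eq_add]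
  · obtain ⟨τ, hτ, hτf⟩ := exists_reflection hB hnd hu
    refine ⟨τ, hτ, fun h hh => by simp [hτf, hH' h hh], ?_⟩
    rw [hτf, hux, neg_div, div_self hu, neg_one_smul, sub_neg_eq_add]

/-- Witt's extension theorem for linearly independent families with the same Gram matrix. -/
theorem exists_isometry_of_linearIndependent [FiniteDimensional F V] (hchar : (2 : F) ≠ 0)
    {B : LinearMap.BilinForm F V} (hB : ∀ u v, B u v = B v u) (hnd : B.Nondegenerate)
    {n : ℕ} {p q : Fin n → V} (hp : LinearIndependent F p) (hq : LinearIndependent F q)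
    (hpq : ∀ i j, B (q i) (q j) = B (p i) (p j)) :
    ∃ τ : V ≃ₗ[F] V, IsIsometry B B τ ∧ ∀ i, τ (p i) = q i := by
  induction n with
  | zero => exact ⟨LinearEquiv.refl F V, fun _ _ => rfl, fun i => i.elim0⟩
  | succ n ih =>
    obtain ⟨τ, hτ, hτp⟩ := ih (linearIndependent_finSucc.1 hp).1 (linearIndependent_finSucc.1 hq).1
      fun i j => hpq i.succ j.succ
    have hτp' : ∀ i : Fin n, τ (p i.succ) = q i.succ := hτp
    have hp' : LinearIndependent F (τ ∘ p) := hp.map' τ.toLinearMap τ.ker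
    have hx := (linearIndependent_finSucc.1 hp').2
    have htail : Fin.tail (τ ∘ p) = Fin.tail q := funext hτp
    rw [htail] at hx
    obtain ⟨σ, hσ, hfix, hσx⟩ := exists_isometry_fixing hchar hB hnd hx
      (linearIndependent_finSucc.1 hq).2 (by rw [Function.comp_apply, hτ, hpq]) (by
        intro h hh
        induction hh using Submodule.span_induction with
        | mem z hz =>
          obtain ⟨i, rfl⟩ := hz
          rw [Fin.tail, hpq, ← hτp' i, Function.comp_apply, hτ]
        | zero => simp
        | add a b _ _ ha hb => rw [map_add, map_add, ha, hb]
        | smul c a _ ha => rw [map_smul, map_smul, ha])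
    refine ⟨τ.trans σ, fun a b => by simp only [LinearEquiv.trans_apply, hσ _ _, hτ _ _],
      fun i => ?_⟩
    refine Fin.cases hσx (fun i => ?_) i
    rw [LinearEquiv.trans_apply, hτp']
    exact hfix _ (Submodule.subset_span ⟨i, rfl⟩)

/-- Witt's extension theorem, for two linear maps with the same kernel and the same induced
form. -/
theorem exists_isometry_of_ker_eq [FiniteDimensional F V] (hchar : (2 : F) ≠ 0)
    {B : LinearMap.BilinForm F V} (hB : ∀ u v, B u v = B v u) (hnd : B.Nondegenerate)
    {M : Type*} [AddCommGroup M] [Module F M] [FiniteDimensional F M] {p q : M →ₗ[F] V}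
    (hker : LinearMap.ker p = LinearMap.ker q) (hpq : ∀ m m', B (q m) (q m') = B (p m) (p m')) :
    ∃ τ : V ≃ₗ[F] V, IsIsometry B B τ ∧ ∀ m, τ (p m) = q m := by
  obtain ⟨C, hC⟩ := (LinearMap.ker p).exists_isCompl
  have hbot : ∀ r : M →ₗ[F] V, LinearMap.ker r = LinearMap.ker p →
      LinearMap.ker (r.domRestrict C) = ⊥ := fun r hr => by
    rw [LinearMap.ker_domRestrict, hr]
    exact Submodule.disjoint_iff_comap_eq_bot.1 hC.disjoint.symm
  let b := Module.finBasis F C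
  obtain ⟨τ, hτ, hτp⟩ := exists_isometry_of_linearIndependent hchar hB hnd
    (b.linearIndependent.map' _ (hbot p rfl)) (b.linearIndependent.map' _ (hbot q hker.symm))
    fun i j => hpq (b i) (b j)
  have hcomp : τ.toLinearMap ∘ₗ p.domRestrict C = q.domRestrict C := b.ext hτp
  refine ⟨τ, hτ, fun m => ?_⟩
  have hm : m ∈ LinearMap.ker p ⊔ C := hC.sup_eq_top ▸ Submodule.mem_top
  obtain ⟨k, hk, c, hc, rfl⟩ := Submodule.mem_sup.1 hm
  have hk' : q k = 0 := by rwa [hker] at hk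
  rw [map_add p, map_add q, LinearMap.mem_ker.1 hk, hk', zero_add, zero_add]
  exact congr($hcomp ⟨c, hc⟩)

end Isometries

section Radical

variable {F M D : Type*} [Field F] [AddCommGroup M] [Module F M] [AddCommGroup D] [Module F D]
  [FiniteDimensional F D]

lemma exists_linearEquiv_comp_eq {i j : D →ₗ[F] M} (hi : Function.Injective i)
    (hj : Function.Injective j) : ∃ ρ : M ≃ₗ[F] M, ∀ d, ρ (i d) = j d := by
  obtain ⟨ρ, hρ⟩ := Submodule.exists_linearEquiv_restrict_eq
    ((LinearEquiv.ofInjective i hi).symm.trans (LinearEquiv.ofInjective j hj))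
  refine ⟨ρ, fun d => ?_⟩
  rw [← LinearEquiv.ofInjective_apply i (h := hi), ← hρ]
  simp

/-- Any two embeddings of a space into the radical differ by an isometry. -/
lemma exists_isometry_of_le_radical {B : LinearMap.BilinForm F M} (hB : ∀ u v, B u v = B v u)
    {i j : D →ₗ[F] M} (hi : Function.Injective i) (hj : Function.Injective j)
    (hiB : ∀ d, i d ∈ LinearMap.ker B) (hjB : ∀ d, j d ∈ LinearMap.ker B) :
    ∃ θ : M ≃ₗ[F] M, IsIsometry B B θ ∧ ∀ d, θ (i d) = j d := by
  obtain ⟨ρ, hρ⟩ := exists_linearEquiv_comp_eq (i := i.codRestrict _ hiB)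
    (j := j.codRestrict _ hjB) (fun a b h => hi congr(($h : M))) (fun a b h => hj congr(($h : M)))
  obtain ⟨C, hC⟩ := (LinearMap.ker B).exists_isCompl
  let e := (LinearMap.ker B).prodEquivOfIsCompl C hC
  have hl : ∀ (r : LinearMap.ker B) v, B r v = 0 := fun r v => by
    rw [LinearMap.mem_ker.1 r.2, LinearMap.zero_apply]
  have hr : ∀ (r : LinearMap.ker B) v, B v r = 0 := fun r v => by rw [hB, hl]
  refine ⟨e.symm ≪≫ₗ (ρ.prodCongr (LinearEquiv.refl F C)) ≪≫ₗ e, fun u v => ?_, fun d => ?_⟩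
  · obtain ⟨⟨r, c⟩, rfl⟩ := e.surjective u
    obtain ⟨⟨s, d⟩, rfl⟩ := e.surjective v
    simp [e, hr]
  · have : i d = e (i.codRestrict _ hiB d, 0) := by simp [e]
    rw [this]
    simp only [LinearEquiv.trans_apply, LinearEquiv.symm_apply_apply, LinearEquiv.prodCongr_apply,
      hρ]
    simp [e]

end Radical

/-- An isometry between `A` and `A'` can be chosen to agree with `φ` on `E ∩ A`. -/
lemma exists_isometryOn_eq_on_inf {F V V' : Type*} [Field F]
    [AddCommGroup V] [Module F V] [AddCommGroup V'] [Module F V'] [FiniteDimensional F V]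
    {B : LinearMap.BilinForm F V} {B' : LinearMap.BilinForm F V'} (hB : ∀ u v, B u v = B v u)
    (hB' : ∀ u v, B' u v = B' v u)
    {E A : Submodule F V} {E' A' : Submodule F V'}
    (hEA : E ≤ B.orthogonal A) (hEA' : E' ≤ B'.orthogonal A') (hAA' : SubIsometric B B' A A')
    (φ : E ≃ₗ[F] E') (hint : ∀ e : E, (e : V) ∈ A → (φ e : V') ∈ A') :
    ∃ χ : A ≃ₗ[F] A', IsIsometryOn B B' A A' χ ∧
      ∀ (e : E) (he : (e : V) ∈ A), (χ ⟨e, he⟩ : V') = φ e := by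
  obtain ⟨ψ, hψ⟩ := hAA'
  let i : A.comap E.subtype →ₗ[F] A :=
    (E.subtype ∘ₗ (A.comap E.subtype).subtype).codRestrict A fun d => d.2
  let j₀ : A.comap E.subtype →ₗ[F] A' :=
    (E'.subtype ∘ₗ φ.toLinearMap ∘ₗ (A.comap E.subtype).subtype).codRestrict A'
      fun d => hint d.1 d.2
  have hi : Function.Injective i := fun a b h => Subtype.ext (Subtype.ext congr(($h : V)))
  have hj₀ : Function.Injective j₀ := fun a b h =>
    Subtype.ext (φ.injective (Subtype.ext congr(($h : V'))))
  obtain ⟨θ, hθ, hθi⟩ := exists_isometry_of_le_radical (B := B.restrict A)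
    (fun u v => hB u v) hi (j := ψ.symm.toLinearMap ∘ₗ j₀) (ψ.symm.injective.comp hj₀)
    (fun d => LinearMap.ext fun a => (hB _ _).trans (hEA d.1.2 a a.2))
    (fun d => LinearMap.ext fun a => by
      change B (ψ.symm (j₀ d) : V) (a : V) = 0
      rw [← hψ, LinearEquiv.apply_symm_apply, hB']
      exact hEA' (φ d.1).2 _ (ψ a).2)
  refine ⟨θ.trans ψ, fun u v => (hψ _ _).trans (hθ u v), fun e he => ?_⟩
  have h := hθi ⟨e, he⟩
  rw [LinearEquiv.trans_apply]
  change θ ⟨e, he⟩ = ψ.symm (j₀ ⟨e, he⟩) at h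
  rw [h, LinearEquiv.apply_symm_apply]
  rfl

end Witt

/-- Corollary 2.5: if `E ⊥ A`, `E' ⊥ A'`, `A ≈ A'`, and `φ : E → E'` is an
isometry with `φ(E ∩ A) = E' ∩ A'`, then `φ` extends to an isometry
`φ_V : V → V'` sending `A` to `A'`. -/
theorem witt_extension_perp {F V V' : Type*} [Field F]
    [AddCommGroup V] [Module F V] [AddCommGroup V'] [Module F V']
    [FiniteDimensional F V] [FiniteDimensional F V']
    (hchar : (2 : F) ≠ 0)
    (B : LinearMap.BilinForm F V) (B' : LinearMap.BilinForm F V')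
    (hB : ∀ u v : V, B u v = B v u) (hB' : ∀ u v : V', B' u v = B' v u)
    (hnd : B.Nondegenerate) (hnd' : B'.Nondegenerate)
    (hVV' : AreIsometric B B')
    (E A : Submodule F V) (E' A' : Submodule F V')
    (hEA : E ≤ B.orthogonal A) (hEA' : E' ≤ B'.orthogonal A')
    (hAA' : SubIsometric B B' A A')
    (φ : E ≃ₗ[F] E') (hφ : IsIsometryOn B B' E E' φ)
    (hint : ∀ e : E, (e : V) ∈ A ↔ (φ e : V') ∈ A') :
    ∃ φV : V ≃ₗ[F] V', IsIsometry B B' φV ∧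
      (∀ e : E, φV (e : V) = (φ e : V')) ∧ A.map φV.toLinearMap = A' := by
  obtain ⟨ψ, hψ⟩ := hVV'
  obtain ⟨χ, hχ, hχφ⟩ := exists_isometryOn_eq_on_inf hB hB' hEA hEA' hAA' φ fun e => (hint e).1
  let p : E × A →ₗ[F] V := E.subtype.coprod A.subtype
  let q : E × A →ₗ[F] V' :=
    (E'.subtype ∘ₗ φ.toLinearMap).coprod (A'.subtype ∘ₗ χ.toLinearMap)
  have hp : ∀ e a, p (e, a) = e + a := fun e a => by simp [p]
  have hq : ∀ e a, q (e, a) = φ e + χ a := fun e a => by simp [q]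
  have hker : LinearMap.ker p = LinearMap.ker q := by
    ext ⟨e, a⟩
    rw [LinearMap.mem_ker, LinearMap.mem_ker, hp, hq]
    constructor
    · intro h
      have he : (e : V) ∈ A := by
        rw [eq_neg_of_add_eq_zero_left h]
        exact A.neg_mem a.2
      have hsum : (⟨e, he⟩ : A) + a = 0 := Subtype.ext h
      rw [← hχφ e he, ← Submodule.coe_add, ← map_add, hsum, map_zero, Submodule.coe_zero]
    · intro h
      have he : (e : V) ∈ A := by
        rw [hint, eq_neg_of_add_eq_zero_left h]
        exact A'.neg_mem (χ a).2
      rw [← hχφ e he, ← Submodule.coe_add, ← map_add] at h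
      have hsum : (⟨e, he⟩ : A) + a = 0 :=
        (map_eq_zero_iff χ χ.injective).1 (Subtype.ext h)
      exact congrArg Subtype.val hsum
  have hform : ∀ m m', B' (q m) (q m') = B (p m) (p m') := by
    rintro ⟨e, a⟩ ⟨f, c⟩
    have h₁ : B (a : V) f = 0 := hEA f.2 a a.2
    have h₂ : B (e : V) c = 0 := (hB _ _).trans (hEA e.2 c c.2)
    have h₃ : B' (χ a : V') (φ f) = 0 := hEA' (φ f).2 _ (χ a).2
    have h₄ : B' (φ e : V') (χ c) = 0 := (hB' _ _).trans (hEA' (φ e).2 _ (χ c).2)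
    simp only [hp, hq, map_add, LinearMap.add_apply, h₁, h₂, h₃, h₄, hφ e f, hχ a c]
  obtain ⟨τ, hτ, hτp⟩ := exists_isometry_of_ker_eq hchar hB hnd (p := p)
    (q := ψ.symm.toLinearMap ∘ₗ q) (by rw [hker, LinearEquiv.ker_comp]) (fun m m' => by
      rw [← hψ, ← hform]
      simp)
  have hext : ∀ m, τ.trans ψ (p m) = q m := fun m => by simp [hτp]
  have hE : ∀ e : E, τ.trans ψ e = φ e := fun e => by simpa [hp, hq] using hext (e, 0)
  have hA : ∀ a : A, τ.trans ψ a = χ a := fun a => by simpa [hp, hq] using hext (0, a)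
  refine ⟨τ.trans ψ, fun u v => (hψ _ _).trans (hτ u v), hE, le_antisymm ?_ fun a' ha' => ?_⟩
  · rintro _ ⟨a, ha, rfl⟩
    exact (hA ⟨a, ha⟩).symm ▸ (χ ⟨a, ha⟩).2
  · refine ⟨χ.symm ⟨a', ha'⟩, (χ.symm ⟨a', ha'⟩).2, (hA _).trans ?_⟩
    rw [LinearEquiv.apply_symm_apply]
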